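/- Classification of boundary values: let κ > 0 and let F be twice differentiable on (0,π) and solve the hedgehog Skyrme ODE on (0,π). Then the limit F₀ = lim_{ψ→0⁺} F(ψ) exists and is an integer multiple of π/2 (i.e. 2·F₀/π ∈ ℤ), and the limit F_π = lim_{ψ→π⁻} F(ψ) exists and is an integer multiple of π/2 (i.e. 2·F_π/π ∈ ℤ). -/

import Mathlib

open Real Set Filter Topology

/-- The hedgehog Skyrme ODE on the three-sphere with coupling constant `κ`:
`(sin²ψ + κ²·sin²F)·F'' + sin(2ψ)·F' + (κ²/2)·sin(2F)·F'² − sin(2F)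
  − (κ²/2)·(sin²F/sin²ψ)·sin(2F) = 0` on `(0, π)`. -/
def SkyrmeEq (κ : ℝ) (F : ℝ → ℝ) : Prop :=
  ∀ ψ ∈ Set.Ioo (0:ℝ) Real.pi,
    (Real.sin ψ ^ 2 + κ ^ 2 * Real.sin (F ψ) ^ 2) * deriv (deriv F) ψ
      + Real.sin (2 * ψ) * deriv F ψ
      + κ ^ 2 / 2 * Real.sin (2 * F ψ) * deriv F ψ ^ 2
      - Real.sin (2 * F ψ)
      - κ ^ 2 / 2 * (Real.sin (F ψ) ^ 2 / Real.sin ψ ^ 2) * Real.sin (2 * F ψ) = 0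

/-- `F` is twice differentiable on `(0, π)`. -/
def TwiceDiffOnIoo (F : ℝ → ℝ) : Prop :=
  ∀ ψ ∈ Set.Ioo (0:ℝ) Real.pi,
    DifferentiableAt ℝ F ψ ∧ DifferentiableAt ℝ (deriv F) ψ

theorem monotoneOn_Ioo_of_hasDerivAt_nonneg {N N' : ℝ → ℝ} {a b : ℝ}
    (hN : ∀ x ∈ Ioo a b, HasDerivAt N (N' x) x) (h0 : ∀ x ∈ Ioo a b, 0 ≤ N' x) :
    MonotoneOn N (Ioo a b) := by
  refine monotoneOn_of_deriv_nonneg (convex_Ioo a b)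
    (fun x hx => (hN x hx).continuousAt.continuousWithinAt) ?_ ?_
  · rw [interior_Ioo]
    exact fun x hx => (hN x hx).differentiableAt.differentiableWithinAt
  · rw [interior_Ioo]
    intro x hx
    rw [(hN x hx).deriv]
    exact h0 x hx

/-- A function whose derivative is dominated by that of a function bounded below has a limit
at the left endpoint. -/
theorem tendsto_of_abs_deriv_le {G M G' M' : ℝ → ℝ} {a b : ℝ} (ha : 0 < a)
    (hG : ∀ x ∈ Ioo 0 a, HasDerivAt G (G' x) x) (hM : ∀ x ∈ Ioo 0 a, HasDerivAt M (M' x) x)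
    (hle : ∀ x ∈ Ioo 0 a, |G' x| ≤ M' x) (hb : ∀ x ∈ Ioo 0 a, b ≤ M x) :
    ∃ l, Tendsto G (𝓝[>] 0) (𝓝 l) := by
  have hadd : MonotoneOn (fun x => M x + G x) (Ioo 0 a) :=
    monotoneOn_Ioo_of_hasDerivAt_nonneg (fun x hx => (hM x hx).add (hG x hx))
      (fun x hx => by linarith [neg_abs_le (G' x), hle x hx])
  have hsub : MonotoneOn (fun x => M x - G x) (Ioo 0 a) :=
    monotoneOn_Ioo_of_hasDerivAt_nonneg (fun x hx => (hM x hx).sub (hG x hx))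
      (fun x hx => by linarith [le_abs_self (G' x), hle x hx])
  have hmem : a / 2 ∈ Ioo 0 a := ⟨by linarith, by linarith⟩
  have key : ∀ {N N₂ : ℝ → ℝ}, MonotoneOn N (Ioo 0 a) → MonotoneOn N₂ (Ioo 0 a) →
      (∀ x, N x + N₂ x = 2 * M x) → ∃ l, Tendsto N (𝓝[>] 0) (𝓝 l) := by
    intro N N₂ h1 h2 h12
    refine ⟨_, h1.tendsto_nhdsWithin_Ioo_right ⟨_, hmem⟩
      ⟨min (N (a / 2)) (2 * b - N₂ (a / 2)), ?_⟩⟩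
    rintro _ ⟨x, hx, rfl⟩
    rcases le_total x (a / 2) with h | h
    · refine (min_le_right _ _).trans ?_
      linarith [h12 x, hb x hx, h2 hx hmem h]
    · exact (min_le_left _ _).trans (h1 hmem hx h)
  obtain ⟨l₁, h₁⟩ := key hadd hsub (fun x => by ring)
  obtain ⟨l₂, h₂⟩ := key hsub hadd (fun x => by ring)
  refine ⟨(l₁ - l₂) / 2, ((h₁.sub h₂).div_const 2).congr fun x => by ring⟩

theorem not_bddBelow_of_div_le_deriv {M M' : ℝ → ℝ} {a b k : ℝ} (ha : 0 < a) (hk : 0 < k)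
    (hM : ∀ x ∈ Ioo 0 a, HasDerivAt M (M' x) x) (hb : ∀ x ∈ Ioo 0 a, b ≤ M x)
    (hle : ∀ᶠ x in 𝓝[>] 0, k / x ≤ M' x) : False := by
  obtain ⟨d, hd, hdle⟩ := mem_nhdsGT_iff_exists_Ioo_subset.1 hle
  have hd : 0 < d := hd
  set e := min a d
  have hpos : 0 < e := lt_min ha hd
  have hea : ∀ x ∈ Ioo 0 e, x ∈ Ioo 0 a := fun x hx => ⟨hx.1, hx.2.trans_le (min_le_left _ _)⟩
  have hder : ∀ x ∈ Ioo 0 e, HasDerivAt (fun x => M x - k * log x) (M' x - k * x⁻¹) x :=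
    fun x hx => (hM x (hea x hx)).sub ((hasDerivAt_log hx.1.ne').const_mul k)
  have hmono : MonotoneOn (fun x => M x - k * log x) (Ioo 0 e) := by
    refine monotoneOn_Ioo_of_hasDerivAt_nonneg hder fun x hx => ?_
    have : k / x ≤ M' x := hdle ⟨hx.1, hx.2.trans_le (min_le_right _ _)⟩
    rw [div_eq_mul_inv] at this
    linarith
  have hmem : e / 2 ∈ Ioo 0 e := ⟨by linarith, by linarith⟩
  have hlog : Tendsto (fun x => k * log x) (𝓝[>] 0) atBot :=
    tendsto_log_nhdsGT_zero.const_mul_atBot hk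
  have hev := hlog.eventually (eventually_lt_atBot (b - (M (e / 2) - k * log (e / 2))))
  obtain ⟨x, hx, hxe⟩ := (hev.and (Ioo_mem_nhdsGT hmem.1)).exists
  have h1 := hmono ⟨hxe.1, hxe.2.trans hmem.2⟩ hmem hxe.2.le
  have h2 := hb x (hea x ⟨hxe.1, hxe.2.trans hmem.2⟩)
  simp only at h1
  linarith

theorem hasDerivAt_sin_pow_four_primitive (x : ℝ) :
    HasDerivAt (fun x => 3 / 8 * x - sin (2 * x) / 4 + sin (4 * x) / 32) (sin x ^ 4) x := by
  have h2 : HasDerivAt (fun x : ℝ => 2 * x) 2 x := by simpa using (hasDerivAt_id x).const_mul 2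
  have h4 : HasDerivAt (fun x : ℝ => 4 * x) 4 x := by simpa using (hasDerivAt_id x).const_mul 4
  have h := (((hasDerivAt_id x).const_mul (3 / 8)).sub (h2.sin.div_const 4)).add
    (h4.sin.div_const 32)
  refine h.congr_deriv ?_
  rw [show 4 * x = 2 * (2 * x) by ring, cos_two_mul (2 * x), cos_two_mul x]
  have := sin_sq_add_cos_sq x
  linear_combination (-(sin x ^ 2) - 1 + cos x ^ 2) * this

theorem exists_tendsto_of_tendsto_sin_pow_four_primitive {F : ℝ → ℝ} {l : Filter ℝ} {h : ℝ}
    (hF : Tendsto (fun x => 3 / 8 * F x - sin (2 * F x) / 4 + sin (4 * F x) / 32) l (𝓝 h)) :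
    ∃ y, Tendsto F l (𝓝 y) := by
  set H : ℝ → ℝ := fun x => 3 / 8 * x - sin (2 * x) / 4 + sin (4 * x) / 32 with hH
  have hder : ∀ x, HasDerivAt H (sin x ^ 4) x := hasDerivAt_sin_pow_four_primitive
  have hmono : Monotone H := monotone_of_deriv_nonneg (fun x => (hder x).differentiableAt)
    (fun x => by rw [(hder x).deriv]; positivity)
  have hstrict : StrictMono H := by
    intro a b hab
    refine lt_of_le_of_ne (hmono hab.le) fun heq => ?_
    have hconst : ∀ x ∈ Ioo a b, H =ᶠ[𝓝 x] fun _ => H a := fun x hx => by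
      filter_upwards [Ioo_mem_nhds hx.1 hx.2] with y hy
      exact le_antisymm ((hmono hy.2.le).trans heq.ge) (hmono hy.1.le)
    have hsin : ∀ x ∈ Ioo a b, sin x = 0 := fun x hx => by
      have h0 : sin x ^ 4 = 0 :=
        (hder x).unique ((hasDerivAt_const x (H a)).congr_of_eventuallyEq (hconst x hx))
      exact pow_eq_zero_iff (by norm_num) |>.1 h0
    have hmem : (a + b) / 2 ∈ Ioo a b := ⟨by linarith, by linarith⟩
    have hcos : cos ((a + b) / 2) = 0 := by
      refine (hasDerivAt_sin _).unique ((hasDerivAt_const _ (0 : ℝ)).congr_of_eventuallyEq ?_)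
      filter_upwards [Ioo_mem_nhds hmem.1 hmem.2] with y hy using hsin y hy
    have := sin_sq_add_cos_sq ((a + b) / 2)
    rw [hcos, hsin _ hmem] at this
    norm_num at this
  have hcont : Continuous H := continuous_iff_continuousAt.2 fun x => (hder x).continuousAt
  have hbound : ∀ x, 3 / 8 * x - 1 ≤ H x ∧ H x ≤ 3 / 8 * x + 1 := fun x => by
    constructor <;> simp only [hH] <;>
      linarith [neg_one_le_sin (2 * x), sin_le_one (2 * x), neg_one_le_sin (4 * x),
        sin_le_one (4 * x)]
  have hsurj : Function.Surjective H := by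
    intro y
    have hm := intermediate_value_Icc (a := (y - 1) * (8 / 3)) (b := (y + 1) * (8 / 3))
      (by linarith) hcont.continuousOn
    have hy : y ∈ Icc (H ((y - 1) * (8 / 3))) (H ((y + 1) * (8 / 3))) :=
      ⟨by linarith [(hbound ((y - 1) * (8 / 3))).2], by linarith [(hbound ((y + 1) * (8 / 3))).1]⟩
    obtain ⟨x, -, hx⟩ := hm hy
    exact ⟨x, hx⟩
  let e := (hstrict.orderIsoOfSurjective H hsurj).toHomeomorph
  refine ⟨e.symm h, ((e.symm.continuous.tendsto h).comp hF).congr fun x => ?_⟩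
  exact e.symm_apply_apply (F x)

theorem exists_tendsto_of_tendsto_cos_zero {F : ℝ → ℝ} {a : ℝ} (ha : 0 < a)
    (hF : ContinuousOn F (Ioo 0 a)) (hs : ∀ x ∈ Ioo 0 a, sin (F x) ≠ 0)
    (hc : Tendsto (fun x => cos (F x)) (𝓝[>] 0) (𝓝 0)) :
    ∃ n : ℤ, Tendsto F (𝓝[>] 0) (𝓝 (n * π + π / 2)) := by
  set n : ℤ := ⌊F (a / 2) / π⌋
  have hmem : a / 2 ∈ Ioo 0 a := ⟨by linarith, by linarith⟩
  have himg : (F '' Ioo 0 a).OrdConnected :=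
    (isPreconnected_Ioo.image F hF).ordConnected
  have hno : ∀ m : ℤ, (m * π : ℝ) ∉ F '' Ioo 0 a := by
    rintro m ⟨x, hx, hxm⟩
    exact hs x hx (by rw [hxm, sin_int_mul_pi])
  have hlo : n * π ≤ F (a / 2) := (le_div_iff₀ pi_pos).1 (Int.floor_le _)
  have hhi : F (a / 2) ≤ ((n + 1 : ℤ) : ℝ) * π := by
    have := (div_lt_iff₀ pi_pos).1 (Int.lt_floor_add_one (F (a / 2) / π))
    push_cast
    exact this.le
  have hrange : ∀ x ∈ Ioo 0 a, n * π < F x ∧ F x < n * π + π := by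
    intro x hx
    constructor
    · by_contra! h
      exact hno n (himg.out ⟨x, hx, rfl⟩ ⟨_, hmem, rfl⟩ ⟨h, hlo⟩)
    · by_contra! h
      refine hno (n + 1) (himg.out ⟨_, hmem, rfl⟩ ⟨x, hx, rfl⟩ ⟨hhi, ?_⟩)
      push_cast
      linarith
  refine ⟨n, ?_⟩
  have hcn : Tendsto (fun x => cos (F x - n * π)) (𝓝[>] 0) (𝓝 0) := by
    have h : ∀ x, cos (F x - n * π) = cos (n * π) * cos (F x) := fun x => by
      rw [cos_sub, sin_int_mul_pi]; ring
    simpa [h] using hc.const_mul (cos (n * π))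
  have hac := (continuous_arccos.tendsto 0).comp hcn
  rw [arccos_zero] at hac
  refine (hac.const_add (n * π)).congr' ?_
  filter_upwards [Ioo_mem_nhdsGT ha] with x hx
  obtain ⟨h1, h2⟩ := hrange x hx
  simp only [Function.comp]
  rw [arccos_cos (by linarith) (by linarith)]
  ring

/-- A Lyapunov function for the hedgehog Skyrme ODE: it is nondecreasing on `(0, π/2)`. -/
noncomputable def skyrmeEnergy (κ : ℝ) (F : ℝ → ℝ) (ψ : ℝ) : ℝ :=
  (sin ψ ^ 2 + κ ^ 2 * sin (F ψ) ^ 2) * sin ψ ^ 2 * deriv F ψ ^ 2 / 2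
    - sin ψ ^ 2 * sin (F ψ) ^ 2 - κ ^ 2 * sin (F ψ) ^ 4 / 4 + sin ψ ^ 2

theorem mem_Ioo_pi_of_mem_Ioo_one {ψ : ℝ} (hψ : ψ ∈ Ioo (0 : ℝ) 1) : ψ ∈ Ioo 0 π :=
  ⟨hψ.1, hψ.2.trans (by linarith [pi_gt_three])⟩

theorem half_le_cos_of_mem_Ioo {ψ : ℝ} (hψ : ψ ∈ Ioo (0 : ℝ) 1) : 1 / 2 ≤ cos ψ := by
  have h : 1 - ψ ^ 2 / 2 ≤ cos ψ := one_sub_sq_div_two_le_cos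
  nlinarith [hψ.1, hψ.2]

theorem neg_sq_div_four_le_skyrmeEnergy (κ : ℝ) (F : ℝ → ℝ) (ψ : ℝ) :
    -(κ ^ 2 / 4) ≤ skyrmeEnergy κ F ψ := by
  have h1 : sin (F ψ) ^ 2 ≤ 1 := sin_sq_le_one _
  have h2 : sin (F ψ) ^ 4 ≤ 1 := by
    rw [show sin (F ψ) ^ 4 = (sin (F ψ) ^ 2) ^ 2 by ring]
    exact pow_le_one₀ (sq_nonneg _) h1
  have h3 : 0 ≤ (sin ψ ^ 2 + κ ^ 2 * sin (F ψ) ^ 2) * sin ψ ^ 2 * deriv F ψ ^ 2 := by positivity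
  have h4 := mul_nonneg (sq_nonneg (sin ψ)) (sub_nonneg.2 h1)
  have h5 := mul_nonneg (sq_nonneg κ) (sub_nonneg.2 h2)
  unfold skyrmeEnergy
  linarith

section

variable {κ : ℝ} {F : ℝ → ℝ} {ψ : ℝ}

theorem SkyrmeEq.mul_sin_sq (hode : SkyrmeEq κ F) (hψ : ψ ∈ Ioo 0 π) :
    (sin ψ ^ 2 + κ ^ 2 * sin (F ψ) ^ 2) * deriv (deriv F) ψ * sin ψ ^ 2
      + 2 * sin ψ ^ 3 * cos ψ * deriv F ψ
      + κ ^ 2 * sin (F ψ) * cos (F ψ) * deriv F ψ ^ 2 * sin ψ ^ 2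
      - 2 * sin (F ψ) * cos (F ψ) * sin ψ ^ 2
      - κ ^ 2 * sin (F ψ) ^ 3 * cos (F ψ) = 0 := by
  have h := hode ψ hψ
  have hs : sin ψ ≠ 0 := (sin_pos_of_mem_Ioo hψ).ne'
  rw [sin_two_mul, sin_two_mul] at h
  have hq : sin (F ψ) ^ 2 / sin ψ ^ 2 * sin ψ ^ 2 = sin (F ψ) ^ 2 :=
    div_mul_cancel₀ _ (pow_ne_zero 2 hs)
  linear_combination sin ψ ^ 2 * h + κ ^ 2 * sin (F ψ) * cos (F ψ) * hq

theorem hasDerivAt_skyrmeEnergy (hF : TwiceDiffOnIoo F) (hode : SkyrmeEq κ F)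
    (hψ : ψ ∈ Ioo 0 π) :
    HasDerivAt (skyrmeEnergy κ F)
      (cos ψ * sin ψ * (κ ^ 2 * sin (F ψ) ^ 2 * deriv F ψ ^ 2 + 2 * cos (F ψ) ^ 2)) ψ := by
  obtain ⟨h1, h2⟩ := hF ψ hψ
  have hs := hasDerivAt_sin ψ
  have hS := h1.hasDerivAt.sin
  have h := ((((((hs.pow 2).add ((hS.pow 2).const_mul (κ ^ 2))).mul (hs.pow 2)).mul
    (h2.hasDerivAt.pow 2)).div_const 2).sub ((hs.pow 2).mul (hS.pow 2))).sub
    (((hS.pow 4).const_mul (κ ^ 2)).div_const 4) |>.add (hs.pow 2)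
  refine h.congr_deriv ?_
  simp only [Pi.pow_apply, Pi.mul_apply, Pi.add_apply]
  have ho := hode.mul_sin_sq hψ
  have ht := sin_sq_add_cos_sq (F ψ)
  push_cast
  linear_combination deriv F ψ * ho - 2 * cos ψ * sin ψ * ht

theorem half_mul_le_deriv_skyrmeEnergy (hψ : ψ ∈ Ioo (0 : ℝ) 1) :
    κ ^ 2 / 2 * (sin ψ * sin (F ψ) ^ 2 * deriv F ψ ^ 2) ≤
      cos ψ * sin ψ * (κ ^ 2 * sin (F ψ) ^ 2 * deriv F ψ ^ 2 + 2 * cos (F ψ) ^ 2) := by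
  have hs : 0 < sin ψ := sin_pos_of_mem_Ioo (mem_Ioo_pi_of_mem_Ioo_one hψ)
  have hc := half_le_cos_of_mem_Ioo hψ
  have h1 : 0 ≤ κ ^ 2 * (sin ψ * sin (F ψ) ^ 2 * deriv F ψ ^ 2) := by positivity
  have h2 : 0 ≤ cos ψ * sin ψ * cos (F ψ) ^ 2 := by positivity
  nlinarith [mul_nonneg (sub_nonneg.2 hc) h1]

theorem monotoneOn_skyrmeEnergy (hF : TwiceDiffOnIoo F) (hode : SkyrmeEq κ F) :
    MonotoneOn (skyrmeEnergy κ F) (Ioo 0 1) := by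
  refine monotoneOn_Ioo_of_hasDerivAt_nonneg
    (fun x hx => hasDerivAt_skyrmeEnergy hF hode (mem_Ioo_pi_of_mem_Ioo_one hx)) fun x hx => ?_
  have hs : 0 < sin x := sin_pos_of_mem_Ioo (mem_Ioo_pi_of_mem_Ioo_one hx)
  refine le_trans ?_ (half_mul_le_deriv_skyrmeEnergy hx)
  positivity

theorem kinetic_le_of_skyrmeEnergy_le {B : ℝ} (h : skyrmeEnergy κ F ψ ≤ B) :
    (sin ψ ^ 2 + κ ^ 2 * sin (F ψ) ^ 2) * (sin ψ * deriv F ψ) ^ 2 ≤ 2 * B + κ ^ 2 / 2 := by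
  have h1 : sin (F ψ) ^ 2 ≤ 1 := sin_sq_le_one _
  have h2 : sin (F ψ) ^ 4 ≤ 1 := by
    rw [show sin (F ψ) ^ 4 = (sin (F ψ) ^ 2) ^ 2 by ring]
    exact pow_le_one₀ (sq_nonneg _) h1
  have h4 := mul_nonneg (sq_nonneg (sin ψ)) (sub_nonneg.2 h1)
  have h5 := mul_nonneg (sq_nonneg κ) (sub_nonneg.2 h2)
  unfold skyrmeEnergy at h
  linarith

theorem sin_sq_le_of_skyrmeEnergy_nonneg (hκ : 0 < κ) (h : 0 ≤ skyrmeEnergy κ F ψ)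
    (hS : 8 * sin ψ ^ 2 ≤ κ ^ 2 * sin (F ψ) ^ 4) :
    sin (F ψ) ^ 2 ≤ 9 * (sin ψ * deriv F ψ) ^ 2 := by
  rcases eq_or_ne (sin (F ψ)) 0 with h0 | h0
  · rw [h0, zero_pow two_ne_zero]
    positivity
  have h1 : sin (F ψ) ^ 2 ≤ 1 := sin_sq_le_one _
  have hpos : 0 < κ ^ 2 * sin (F ψ) ^ 2 := by positivity
  have hD : sin ψ ^ 2 + κ ^ 2 * sin (F ψ) ^ 2 ≤ 2 * (κ ^ 2 * sin (F ψ) ^ 2) := by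
    nlinarith [mul_nonneg hpos.le (sub_nonneg.2 h1)]
  have hmul := mul_le_mul_of_nonneg_right hD (sq_nonneg (sin ψ * deriv F ψ))
  unfold skyrmeEnergy at h
  refine le_of_mul_le_mul_left ?_ hpos
  nlinarith [mul_nonneg (sq_nonneg (sin ψ)) (sub_nonneg.2 h1),
    mul_nonneg hpos.le (sq_nonneg (sin ψ * deriv F ψ)), mul_nonneg (sq_nonneg (sin ψ))
      (sq_nonneg (sin (F ψ)))]

theorem sin_pow_four_mul_abs_deriv_le {B : ℝ} (hκ : 0 < κ) (hψ : ψ ∈ Ioo 0 π)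
    (h : 0 ≤ skyrmeEnergy κ F ψ) (hB : skyrmeEnergy κ F ψ ≤ B) :
    sin (F ψ) ^ 4 * |deriv F ψ| ≤ 3 * (sin ψ * sin (F ψ) ^ 2 * deriv F ψ ^ 2)
      + 8 / κ ^ 2 * (2 * B + κ ^ 2 / 2 + 1) := by
  have hs : 0 < sin ψ := sin_pos_of_mem_Ioo hψ
  have hkin := kinetic_le_of_skyrmeEnergy_le hB
  have hf := abs_nonneg (deriv F ψ)
  have hB0 : 0 ≤ B := h.trans hB
  rcases le_total (8 * sin ψ ^ 2) (κ ^ 2 * sin (F ψ) ^ 4) with hS | hS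
  · have h1 := sin_sq_le_of_skyrmeEnergy_nonneg hκ h hS
    have h2 : |sin (F ψ)| ≤ 3 * (sin ψ * |deriv F ψ|) := by
      refine abs_le_of_sq_le_sq (h1.trans_eq ?_) (by positivity)
      rw [mul_pow, mul_pow, mul_pow, sq_abs]
      ring
    have h3 : sin (F ψ) ^ 2 ≤ 3 * (sin ψ * |deriv F ψ|) := by
      rw [← sq_abs]
      nlinarith [abs_sin_le_one (F ψ), abs_nonneg (sin (F ψ))]
    have h4 := mul_le_mul_of_nonneg_left h3 (mul_nonneg (sq_nonneg (sin (F ψ))) hf)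
    have h5 : 0 ≤ 8 / κ ^ 2 * (2 * B + κ ^ 2 / 2 + 1) := by positivity
    rw [← sq_abs (deriv F ψ)]
    linarith
  · have h1 : (sin ψ ^ 2 * |deriv F ψ|) ^ 2 ≤ 2 * B + κ ^ 2 / 2 := by
      refine le_trans ?_ hkin
      rw [mul_pow, sq_abs]
      nlinarith [mul_nonneg (mul_nonneg (sq_nonneg κ) (sq_nonneg (sin (F ψ))))
        (sq_nonneg (sin ψ * deriv F ψ))]
    have h2 : sin ψ ^ 2 * |deriv F ψ| ≤ 2 * B + κ ^ 2 / 2 + 1 := by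
      nlinarith [sq_nonneg (sin ψ ^ 2 * |deriv F ψ| - 1)]
    have h3 : sin (F ψ) ^ 4 ≤ 8 / κ ^ 2 * sin ψ ^ 2 := by
      rw [div_mul_eq_mul_div, le_div_iff₀ (by positivity)]
      linarith
    have h4 : 0 ≤ sin ψ * sin (F ψ) ^ 2 * deriv F ψ ^ 2 := by positivity
    calc sin (F ψ) ^ 4 * |deriv F ψ| ≤ 8 / κ ^ 2 * sin ψ ^ 2 * |deriv F ψ| := by gcongr
      _ = 8 / κ ^ 2 * (sin ψ ^ 2 * |deriv F ψ|) := by ring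
      _ ≤ 8 / κ ^ 2 * (2 * B + κ ^ 2 / 2 + 1) := by gcongr
      _ ≤ _ := by linarith

/-- The boundary value in the case of nonnegative limiting energy. -/
theorem exists_tendsto_int_mul_pi_of_skyrmeEnergy_nonneg (hκ : 0 < κ) (hF : TwiceDiffOnIoo F)
    (hode : SkyrmeEq κ F) (h0 : ∀ x ∈ Ioo (0 : ℝ) 1, 0 ≤ skyrmeEnergy κ F x) :
    ∃ n : ℤ, Tendsto F (𝓝[>] 0) (𝓝 (n * π)) := by
  have hhalf : (1 / 2 : ℝ) ∈ Ioo (0 : ℝ) 1 := by constructor <;> norm_num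
  have hsub : ∀ x ∈ Ioo (0 : ℝ) (1 / 2), x ∈ Ioo (0 : ℝ) 1 :=
    fun x hx => ⟨hx.1, hx.2.trans hhalf.2⟩
  have hpi : ∀ x ∈ Ioo (0 : ℝ) (1 / 2), x ∈ Ioo 0 π :=
    fun x hx => mem_Ioo_pi_of_mem_Ioo_one (hsub x hx)
  set B := skyrmeEnergy κ F (1 / 2) with hB
  have hB0 : 0 ≤ B := h0 _ hhalf
  set R := 8 / κ ^ 2 * (2 * B + κ ^ 2 / 2 + 1) with hR
  have hR0 : 0 ≤ R := by positivity
  have hEder : ∀ x ∈ Ioo (0 : ℝ) (1 / 2), HasDerivAt (skyrmeEnergy κ F) _ x :=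
    fun x hx => hasDerivAt_skyrmeEnergy hF hode (hpi x hx)
  obtain ⟨h, hh⟩ : ∃ h, Tendsto (fun x => 3 / 8 * F x - sin (2 * F x) / 4 + sin (4 * F x) / 32)
      (𝓝[>] 0) (𝓝 h) := by
    refine tendsto_of_abs_deriv_le (a := 1 / 2) (b := 0)
      (M := fun x => 6 / κ ^ 2 * skyrmeEnergy κ F x + 2 * R * sin x) (by norm_num)
      (fun x hx => (hasDerivAt_sin_pow_four_primitive (F x)).comp x (hF x (hpi x hx)).1.hasDerivAt)
      (fun x hx => ((hEder x hx).const_mul _).add ((hasDerivAt_sin x).const_mul _)) ?_ ?_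
    · intro x hx
      have h1 := sin_pow_four_mul_abs_deriv_le hκ (hpi x hx) (h0 x (hsub x hx))
        (monotoneOn_skyrmeEnergy hF hode (hsub x hx) hhalf hx.2.le)
      have h2 := mul_le_mul_of_nonneg_left
        (half_mul_le_deriv_skyrmeEnergy (κ := κ) (F := F) (hsub x hx))
        (show 0 ≤ 6 / κ ^ 2 by positivity)
      have h3 := mul_le_mul_of_nonneg_left (half_le_cos_of_mem_Ioo (hsub x hx)) hR0
      have h4 : 6 / κ ^ 2 * (κ ^ 2 / 2 * (sin x * sin (F x) ^ 2 * deriv F x ^ 2)) =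
          3 * (sin x * sin (F x) ^ 2 * deriv F x ^ 2) := by
        field_simp
        ring
      rw [abs_mul, abs_of_nonneg (show 0 ≤ sin (F x) ^ 4 by positivity)]
      linarith
    · intro x hx
      have h1 := h0 x (hsub x hx)
      have h2 : 0 < sin x := sin_pos_of_mem_Ioo (hpi x hx)
      positivity
  obtain ⟨y, hy⟩ := exists_tendsto_of_tendsto_sin_pow_four_primitive hh
  suffices hsin : sin y = 0 by
    obtain ⟨n, hn⟩ := sin_eq_zero_iff.1 hsin
    exact ⟨n, hn ▸ hy⟩
  by_contra hne
  have hS : Tendsto (fun x => sin (F x)) (𝓝[>] 0) (𝓝 (sin y)) :=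
    (continuous_sin.tendsto y).comp hy
  have hs : Tendsto sin (𝓝[>] 0) (𝓝 0) := by
    simpa using (continuous_sin.tendsto 0).mono_left nhdsWithin_le_nhds
  have hy2 : 0 < sin y ^ 2 := by positivity
  have hev1 : ∀ᶠ x in 𝓝[>] (0 : ℝ), sin y ^ 2 / 2 < sin (F x) ^ 2 :=
    (hS.pow 2).eventually (lt_mem_nhds (by linarith))
  have hev2 : ∀ᶠ x in 𝓝[>] (0 : ℝ), 8 * sin x ^ 2 - κ ^ 2 * sin (F x) ^ 4 < 0 := by
    refine (((hs.pow 2).const_mul 8).sub ((hS.pow 4).const_mul (κ ^ 2))).eventually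
      (gt_mem_nhds ?_)
    have : 0 < κ ^ 2 * sin y ^ 4 := by positivity
    linarith
  refine not_bddBelow_of_div_le_deriv (a := 1 / 2) (b := 0)
    (k := κ ^ 2 / 2 * ((sin y ^ 2 / 2) ^ 2 / 9)) (by norm_num) (by positivity) hEder
    (fun x hx => h0 x (hsub x hx)) ?_
  filter_upwards [hev1, hev2, Ioo_mem_nhdsGT (show (0 : ℝ) < 1 / 2 by norm_num)] with x h1 h2 hx
  have hsx : 0 < sin x := sin_pos_of_mem_Ioo (hpi x hx)
  have h3 := sin_sq_le_of_skyrmeEnergy_nonneg hκ (h0 x (hsub x hx)) (by linarith)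
  refine le_trans ?_ (half_mul_le_deriv_skyrmeEnergy (hsub x hx))
  rw [mul_div_assoc]
  refine mul_le_mul_of_nonneg_left ?_ (by positivity)
  calc (sin y ^ 2 / 2) ^ 2 / 9 / x ≤ (sin y ^ 2 / 2) ^ 2 / 9 / sin x := by
        gcongr
        exact sin_le hx.1.le
    _ ≤ sin (F x) ^ 2 * (sin x * deriv F x) ^ 2 / sin x := by
        gcongr
        nlinarith
    _ = _ := by
        field_simp

theorem sin_sq_ge_of_skyrmeEnergy_le {η : ℝ} (hκ : 0 < κ) (h : skyrmeEnergy κ F ψ ≤ -η) :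
    4 * η / κ ^ 2 ≤ sin (F ψ) ^ 2 := by
  have h1 : sin (F ψ) ^ 2 ≤ 1 := sin_sq_le_one _
  have h3 : 0 ≤ (sin ψ ^ 2 + κ ^ 2 * sin (F ψ) ^ 2) * sin ψ ^ 2 * deriv F ψ ^ 2 := by positivity
  have h4 := mul_nonneg (sq_nonneg (sin ψ)) (sub_nonneg.2 h1)
  have h5 := mul_nonneg (mul_nonneg (sq_nonneg κ) (sq_nonneg (sin (F ψ)))) (sub_nonneg.2 h1)
  unfold skyrmeEnergy at h
  rw [div_le_iff₀ (by positivity)]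
  linarith

/-- In the variable `t` with `d/dt = sin ψ · d/dψ`, the derivative of the virial quantity
`cos F · sin F · Ḟ + cos² F / 2` is `cos² F · sin² F - sin² F · Ḟ²` up to a small error. -/
theorem hasDerivAt_skyrme_virial (hF : TwiceDiffOnIoo F) (hode : SkyrmeEq κ F)
    (hψ : ψ ∈ Ioo 0 π) :
    HasDerivAt (fun x => cos (F x) * sin (F x) * (sin x * deriv F x) + cos (F x) ^ 2 / 2)
      ((cos (F ψ) ^ 2 * sin (F ψ) ^ 2 - sin (F ψ) ^ 2 * (sin ψ * deriv F ψ) ^ 2) / sin ψ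
        - (1 - cos ψ) * (cos (F ψ) * sin (F ψ) * deriv F ψ)
        + sin ψ / (sin ψ ^ 2 + κ ^ 2 * sin (F ψ) ^ 2) * cos (F ψ)
          * (-2 * cos ψ * sin (F ψ) * (sin ψ * deriv F ψ)
            + cos (F ψ) * (sin ψ * deriv F ψ) ^ 2 + cos (F ψ) * sin (F ψ) ^ 2)) ψ := by
  obtain ⟨h1, h2⟩ := hF ψ hψ
  have hS := h1.hasDerivAt.sin
  have hC := h1.hasDerivAt.cos
  have h := ((hC.mul hS).mul ((hasDerivAt_sin ψ).mul h2.hasDerivAt)).add ((hC.pow 2).div_const 2)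
  refine h.congr_deriv ?_
  have hs : 0 < sin ψ := sin_pos_of_mem_Ioo hψ
  have hD : sin ψ ^ 2 + κ ^ 2 * sin (F ψ) ^ 2 ≠ 0 := by positivity
  have ho := hode.mul_sin_sq hψ
  simp only [Pi.mul_apply]
  field_simp
  push_cast
  linear_combination 2 * cos (F ψ) * sin (F ψ) * ho

theorem skyrme_virial_deriv_ge {δ P : ℝ} (hκ : 0 < κ) (hδ : 0 < δ) (hψ : ψ ∈ Ioo (0 : ℝ) 1)
    (hS : δ ≤ sin (F ψ) ^ 2) (hP : |sin ψ * deriv F ψ| ≤ P) :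
    (cos (F ψ) ^ 2 * sin (F ψ) ^ 2 - sin (F ψ) ^ 2 * (sin ψ * deriv F ψ) ^ 2) / sin ψ
        - (P + 2 * P / (κ ^ 2 * δ)) ≤
      (cos (F ψ) ^ 2 * sin (F ψ) ^ 2 - sin (F ψ) ^ 2 * (sin ψ * deriv F ψ) ^ 2) / sin ψ
        - (1 - cos ψ) * (cos (F ψ) * sin (F ψ) * deriv F ψ)
        + sin ψ / (sin ψ ^ 2 + κ ^ 2 * sin (F ψ) ^ 2) * cos (F ψ)
          * (-2 * cos ψ * sin (F ψ) * (sin ψ * deriv F ψ)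
            + cos (F ψ) * (sin ψ * deriv F ψ) ^ 2 + cos (F ψ) * sin (F ψ) ^ 2) := by
  have hs : 0 < sin ψ := sin_pos_of_mem_Ioo (mem_Ioo_pi_of_mem_Ioo_one hψ)
  have hc := half_le_cos_of_mem_Ioo hψ
  have hc1 := cos_le_one ψ
  have hs1 := sin_le_one ψ
  have hP0 : 0 ≤ P := (abs_nonneg _).trans hP
  have hCS : |cos (F ψ) * sin (F ψ)| ≤ 1 := by
    rw [abs_mul]
    exact mul_le_one₀ (abs_cos_le_one _) (abs_nonneg _) (abs_sin_le_one _)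
  have h1c : 1 - cos ψ ≤ sin ψ := by nlinarith [sin_sq_add_cos_sq ψ]
  have hfirst : (1 - cos ψ) * (cos (F ψ) * sin (F ψ) * deriv F ψ) ≤ P := by
    calc (1 - cos ψ) * (cos (F ψ) * sin (F ψ) * deriv F ψ)
        ≤ |(1 - cos ψ) * (cos (F ψ) * sin (F ψ) * deriv F ψ)| := le_abs_self _
      _ = (1 - cos ψ) * (|cos (F ψ) * sin (F ψ)| * |deriv F ψ|) := by
          rw [abs_mul, abs_mul (cos (F ψ) * sin (F ψ)), abs_of_nonneg (sub_nonneg.2 hc1)]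
      _ ≤ sin ψ * (1 * |deriv F ψ|) := by gcongr
      _ = |sin ψ * deriv F ψ| := by rw [abs_mul, abs_of_pos hs, one_mul]
      _ ≤ P := hP
  have hD : κ ^ 2 * δ ≤ sin ψ ^ 2 + κ ^ 2 * sin (F ψ) ^ 2 := by
    nlinarith [mul_le_mul_of_nonneg_left hS (sq_nonneg κ), sq_nonneg (sin ψ)]
  have hκδ : 0 < κ ^ 2 * δ := by positivity
  have hD0 := hκδ.trans_le hD
  set D := sin ψ ^ 2 + κ ^ 2 * sin (F ψ) ^ 2
  have hsecond : 2 * (sin ψ * cos ψ * (cos (F ψ) * sin (F ψ) * (sin ψ * deriv F ψ))) / D ≤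
      2 * P / (κ ^ 2 * δ) := by
    have hnum : sin ψ * cos ψ * (cos (F ψ) * sin (F ψ) * (sin ψ * deriv F ψ)) ≤ P := by
      have hsc : |sin ψ * cos ψ| ≤ 1 := by
        rw [abs_mul]
        exact mul_le_one₀ (abs_sin_le_one _) (abs_nonneg _) (abs_cos_le_one _)
      calc sin ψ * cos ψ * (cos (F ψ) * sin (F ψ) * (sin ψ * deriv F ψ))
          ≤ |sin ψ * cos ψ * (cos (F ψ) * sin (F ψ) * (sin ψ * deriv F ψ))| := le_abs_self _
        _ = |sin ψ * cos ψ| * (|cos (F ψ) * sin (F ψ)| * |sin ψ * deriv F ψ|) := by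
            rw [abs_mul, abs_mul (cos (F ψ) * sin (F ψ))]
        _ ≤ 1 * (1 * P) := by gcongr
        _ = P := by ring
    exact (div_le_div_of_nonneg_right (by linarith) hD0.le).trans
      (div_le_div_of_nonneg_left (by positivity) hκδ hD)
  have hthird : 0 ≤ sin ψ / D *
      (cos (F ψ) ^ 2 * ((sin ψ * deriv F ψ) ^ 2 + sin (F ψ) ^ 2)) := by positivity
  have hsplit : sin ψ / D * cos (F ψ) * (-2 * cos ψ * sin (F ψ) * (sin ψ * deriv F ψ)
      + cos (F ψ) * (sin ψ * deriv F ψ) ^ 2 + cos (F ψ) * sin (F ψ) ^ 2) =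
      sin ψ / D * (cos (F ψ) ^ 2 * ((sin ψ * deriv F ψ) ^ 2 + sin (F ψ) ^ 2))
      - 2 * (sin ψ * cos ψ * (cos (F ψ) * sin (F ψ) * (sin ψ * deriv F ψ))) / D := by
    ring
  rw [hsplit]
  linarith

/-- The boundary value in the case of negative limiting energy. -/
theorem exists_tendsto_of_skyrmeEnergy_neg (hκ : 0 < κ) (hF : TwiceDiffOnIoo F)
    (hode : SkyrmeEq κ F) {a : ℝ} (ha : a ∈ Ioo (0 : ℝ) 1) (hneg : skyrmeEnergy κ F a < 0) :
    ∃ n : ℤ, Tendsto F (𝓝[>] 0) (𝓝 (n * π + π / 2)) := by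
  have hsub : ∀ x ∈ Ioo (0 : ℝ) a, x ∈ Ioo (0 : ℝ) 1 := fun x hx => ⟨hx.1, hx.2.trans ha.2⟩
  have hpi : ∀ x ∈ Ioo (0 : ℝ) a, x ∈ Ioo 0 π :=
    fun x hx => mem_Ioo_pi_of_mem_Ioo_one (hsub x hx)
  have hle : ∀ x ∈ Ioo (0 : ℝ) a, skyrmeEnergy κ F x ≤ skyrmeEnergy κ F a :=
    fun x hx => monotoneOn_skyrmeEnergy hF hode (hsub x hx) ha hx.2.le
  obtain ⟨δ, hδ, hS⟩ : ∃ δ > 0, ∀ x ∈ Ioo (0 : ℝ) a, δ ≤ sin (F x) ^ 2 := by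
    refine ⟨4 * (-skyrmeEnergy κ F a) / κ ^ 2, ?_, fun x hx =>
      sin_sq_ge_of_skyrmeEnergy_le hκ (by linarith [hle x hx])⟩
    have : 0 < -skyrmeEnergy κ F a := by linarith
    positivity
  obtain ⟨P, hP⟩ : ∃ P, ∀ x ∈ Ioo (0 : ℝ) a, |sin x * deriv F x| ≤ P := by
    refine ⟨1 / (2 * δ) + 1, fun x hx => ?_⟩
    have hkin := kinetic_le_of_skyrmeEnergy_le ((hle x hx).trans hneg.le)
    have h1 : κ ^ 2 * (δ * (sin x * deriv F x) ^ 2) ≤ κ ^ 2 * (1 / 2) := by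
      have hD : κ ^ 2 * δ ≤ sin x ^ 2 + κ ^ 2 * sin (F x) ^ 2 := by
        nlinarith [mul_le_mul_of_nonneg_left (hS x hx) (sq_nonneg κ), sq_nonneg (sin x)]
      linarith [mul_le_mul_of_nonneg_right hD (sq_nonneg (sin x * deriv F x))]
    have h2 := le_of_mul_le_mul_left h1 (by positivity)
    have h3 : |sin x * deriv F x| ^ 2 ≤ 1 / (2 * δ) := by
      rw [sq_abs, le_div_iff₀ (by positivity)]
      linarith
    nlinarith [sq_nonneg (|sin x * deriv F x| - 1)]
  have hmem : a / 2 ∈ Ioo 0 a := ⟨by linarith [ha.1], by linarith [ha.1]⟩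
  have hP0 : 0 ≤ P := (abs_nonneg _).trans (hP _ hmem)
  set R := P + 2 * P / (κ ^ 2 * δ) with hR
  have hR0 : 0 ≤ R := by positivity
  let M : ℝ → ℝ := fun x =>
    (cos (F x) * sin (F x) * (sin x * deriv F x) + cos (F x) ^ 2 / 2)
      + (4 / κ ^ 2 * skyrmeEnergy κ F x + 2 * R * sin x)
  have hMder : ∀ x ∈ Ioo (0 : ℝ) a, HasDerivAt M _ x := fun x hx =>
    (hasDerivAt_skyrme_virial hF hode (hpi x hx)).add
      (((hasDerivAt_skyrmeEnergy hF hode (hpi x hx)).const_mul (4 / κ ^ 2)).add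
        ((hasDerivAt_sin x).const_mul (2 * R)))
  have hMder_eq : ∀ x ∈ Ioo (0 : ℝ) a, HasDerivAt M (deriv M x) x := fun x hx =>
    (hMder x hx).differentiableAt.hasDerivAt
  have hMge : ∀ x ∈ Ioo (0 : ℝ) a,
      (cos (F x) ^ 2 * sin (F x) ^ 2 + sin (F x) ^ 2 * (sin x * deriv F x) ^ 2) / sin x ≤
        deriv M x := by
    intro x hx
    rw [(hMder x hx).deriv]
    have hs : 0 < sin x := sin_pos_of_mem_Ioo (hpi x hx)
    have h1 := skyrme_virial_deriv_ge hκ hδ (hsub x hx) (hS x hx) (hP x hx)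
    have h2 := mul_le_mul_of_nonneg_left
      (half_mul_le_deriv_skyrmeEnergy (κ := κ) (F := F) (hsub x hx))
      (show 0 ≤ 4 / κ ^ 2 by positivity)
    have h3 := mul_le_mul_of_nonneg_left (half_le_cos_of_mem_Ioo (hsub x hx)) hR0
    have h4 : 4 / κ ^ 2 * (κ ^ 2 / 2 * (sin x * sin (F x) ^ 2 * deriv F x ^ 2)) =
        2 * (sin (F x) ^ 2 * (sin x * deriv F x) ^ 2 / sin x) := by
      field_simp
      ring
    rw [add_div, sub_div]
    rw [sub_div] at h1
    linarith
  have hMb : ∀ x ∈ Ioo (0 : ℝ) a, -P - 1 ≤ M x := by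
    intro x hx
    have hs : 0 < sin x := sin_pos_of_mem_Ioo (hpi x hx)
    have h1 : |cos (F x) * sin (F x) * (sin x * deriv F x)| ≤ 1 * 1 * P := by
      rw [abs_mul, abs_mul (cos (F x))]
      gcongr
      · exact abs_cos_le_one _
      · exact abs_sin_le_one _
      · exact hP x hx
    have h2 := mul_le_mul_of_nonneg_left (neg_sq_div_four_le_skyrmeEnergy κ F x)
      (show 0 ≤ 4 / κ ^ 2 by positivity)
    have h3 : 4 / κ ^ 2 * -(κ ^ 2 / 4) = -1 := by field_simp
    have h4 : 0 ≤ 2 * R * sin x := by positivity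
    simp only [M]
    linarith [neg_abs_le (cos (F x) * sin (F x) * (sin x * deriv F x)), sq_nonneg (cos (F x))]
  have hδ1 : δ ≤ 1 := (hS _ hmem).trans (sin_sq_le_one _)
  obtain ⟨l, hl⟩ : ∃ l, Tendsto (fun x => δ * cos (F x) ^ 2) (𝓝[>] 0) (𝓝 l) := by
    refine tendsto_of_abs_deriv_le ha.1
      (fun x hx => (((hF x (hpi x hx)).1.hasDerivAt.cos.pow 2).const_mul δ)) hMder_eq ?_ hMb
    intro x hx
    have hs : 0 < sin x := sin_pos_of_mem_Ioo (hpi x hx)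
    refine le_trans ?_ (hMge x hx)
    rw [le_div_iff₀ hs, ← abs_of_pos hs, ← abs_mul, abs_of_pos hs]
    push_cast
    have h1 := mul_le_mul_of_nonneg_left (hS x hx) (sq_nonneg (cos (F x)))
    have h2 := mul_le_mul_of_nonneg_right hδ1
      (mul_nonneg (sq_nonneg (sin (F x))) (sq_nonneg (sin x * deriv F x)))
    rw [abs_le]
    constructor <;>
      nlinarith [mul_nonneg hδ.le (sq_nonneg (cos (F x) - sin (F x) * (sin x * deriv F x))),
        mul_nonneg hδ.le (sq_nonneg (cos (F x) + sin (F x) * (sin x * deriv F x)))]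
  have hl0 : 0 ≤ l := ge_of_tendsto' hl fun x => by positivity
  have hlz : l = 0 := by
    by_contra hne
    have hlpos : 0 < l := lt_of_le_of_ne hl0 (Ne.symm hne)
    refine not_bddBelow_of_div_le_deriv ha.1 (half_pos hlpos) hMder_eq hMb ?_
    filter_upwards [hl.eventually (lt_mem_nhds (half_lt_self hlpos)), Ioo_mem_nhdsGT ha.1]
      with x h1 hx
    have hs : 0 < sin x := sin_pos_of_mem_Ioo (hpi x hx)
    refine le_trans ?_ (hMge x hx)
    have h2 := mul_le_mul_of_nonneg_left (hS x hx) (sq_nonneg (cos (F x)))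
    have h3 := mul_nonneg (sq_nonneg (sin (F x))) (sq_nonneg (sin x * deriv F x))
    calc l / 2 / x ≤ l / 2 / sin x := by
          gcongr
          exact sin_le hx.1.le
      _ ≤ _ := by
          gcongr
          linarith
  refine exists_tendsto_of_tendsto_cos_zero ha.1
    (fun x hx => (hF x (hpi x hx)).1.continuousAt.continuousWithinAt) (fun x hx h => ?_) ?_
  · have := hS x hx
    rw [h] at this
    norm_num at this
    linarith
  · have h1 := (hl.const_mul δ⁻¹).sqrt
    rw [hlz, mul_zero, sqrt_zero] at h1
    refine (tendsto_zero_iff_abs_tendsto_zero _).2 (h1.congr fun x => ?_)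
    rw [inv_mul_cancel_left₀ hδ.ne', sqrt_sq_eq_abs]
    rfl

theorem exists_tendsto_nhdsGT_zero_of_skyrmeEq (hκ : 0 < κ) (hF : TwiceDiffOnIoo F)
    (hode : SkyrmeEq κ F) :
    ∃ F₀ : ℝ, Tendsto F (𝓝[>] 0) (𝓝 F₀) ∧ ∃ k : ℤ, 2 * F₀ / π = k := by
  have hπ := pi_ne_zero
  by_cases h0 : ∀ x ∈ Ioo (0 : ℝ) 1, 0 ≤ skyrmeEnergy κ F x
  · obtain ⟨n, hn⟩ := exists_tendsto_int_mul_pi_of_skyrmeEnergy_nonneg hκ hF hode h0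
    refine ⟨_, hn, 2 * n, ?_⟩
    push_cast
    field_simp
  · push Not at h0
    obtain ⟨a, ha, hneg⟩ := h0
    obtain ⟨n, hn⟩ := exists_tendsto_of_skyrmeEnergy_neg hκ hF hode ha hneg
    refine ⟨_, hn, 2 * n + 1, ?_⟩
    push_cast
    field_simp

theorem deriv_deriv_comp_const_sub (F : ℝ → ℝ) (a x : ℝ) :
    deriv (deriv fun y => F (a - y)) x = deriv (deriv F) (a - x) := by
  have h : deriv (fun y => F (a - y)) = fun y => -deriv F (a - y) :=
    funext fun y => deriv_comp_const_sub _ _ y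
  rw [h, deriv.fun_neg, deriv_comp_const_sub, neg_neg]

theorem TwiceDiffOnIoo.comp_pi_sub (hF : TwiceDiffOnIoo F) :
    TwiceDiffOnIoo fun x => F (π - x) := by
  intro x hx
  obtain ⟨h1, h2⟩ := hF (π - x) ⟨by linarith [hx.2], by linarith [hx.1]⟩
  have h : deriv (fun y => F (π - y)) = fun y => -deriv F (π - y) :=
    funext fun y => deriv_comp_const_sub _ _ y
  have hsub : DifferentiableAt ℝ (fun y => π - y) x := by fun_prop
  refine ⟨h1.comp x hsub, ?_⟩
  rw [h]
  exact (h2.comp x hsub).neg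

theorem SkyrmeEq.comp_pi_sub (hode : SkyrmeEq κ F) : SkyrmeEq κ fun x => F (π - x) := by
  intro x hx
  have h := hode (π - x) ⟨by linarith [hx.2], by linarith [hx.1]⟩
  rw [deriv_deriv_comp_const_sub, deriv_comp_const_sub]
  rw [sin_two_mul (π - x), cos_pi_sub, sin_pi_sub] at h
  rw [sin_two_mul x]
  linear_combination h

end

/-- Classification of boundary values: a solution `F` of the hedgehog Skyrme
ODE on `(0,π)` has limits `F₀` as `ψ → 0⁺` and `F_π` as `ψ → π⁻`, and both
are integer multiples of `π/2` (i.e. `2·F₀/π ∈ ℤ` and `2·F_π/π ∈ ℤ`). -/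
theorem skyrme_boundary_values (κ : ℝ) (hκ : 0 < κ) (F : ℝ → ℝ)
    (hF : TwiceDiffOnIoo F) (hode : SkyrmeEq κ F) :
    (∃ F₀ : ℝ, Filter.Tendsto F (nhdsWithin 0 (Set.Ioi 0)) (nhds F₀) ∧
        ∃ k : ℤ, 2 * F₀ / Real.pi = k) ∧
      (∃ Fπ : ℝ, Filter.Tendsto F (nhdsWithin Real.pi (Set.Iio Real.pi)) (nhds Fπ) ∧
        ∃ l : ℤ, 2 * Fπ / Real.pi = l) := by
  refine ⟨exists_tendsto_nhdsGT_zero_of_skyrmeEq hκ hF hode, ?_⟩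
  obtain ⟨y, hy, hk⟩ := exists_tendsto_nhdsGT_zero_of_skyrmeEq hκ hF.comp_pi_sub hode.comp_pi_sub
  refine ⟨y, ?_, hk⟩
  have hsub : Tendsto (fun x => π - x) (𝓝[<] π) (𝓝[>] 0) := by
    refine tendsto_nhdsWithin_iff.2 ⟨?_, ?_⟩
    · have h : Tendsto (fun x => π - x) (𝓝 π) (𝓝 (π - π)) := tendsto_const_nhds.sub tendsto_id
      rw [sub_self] at h
      exact h.mono_left nhdsWithin_le_nhds
    · filter_upwards [self_mem_nhdsWithin] with x hx using sub_pos.2 (mem_Iio.1 hx)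
  exact (hy.comp hsub).congr fun x => by simp
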